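/- arXiv:1310.2783 — 2 statements merged into one kernel-verified Lean document; each statement's English description precedes it below -/
import Mathlib

section
/- For every pair of positive integers ℓ, r with r ≥ 3, there exists a positive integer N = N(ℓ,r) such that for every integer n ≥ N: rx_{3,ℓ}(K_{r×n}) = 3 if r = 3 and ℓ ∈ {1,2,3}; rx_{3,ℓ}(K_{r×n}) = 4 if r = 3 and ℓ ≥ 4; and rx_{3,ℓ}(K_{r×n}) = 3 if r ≥ 4. -/
open SimpleGraph

/-- `T` is a rainbow `S`-tree in `G` under edge-coloring `c`:
its vertices contain `S`, it is a tree, and `c` is injective on its edges. -/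
def IsRainbowSTree {V β : Type*} (G : SimpleGraph V) (c : Sym2 V → β)
    (S : Set V) (T : G.Subgraph) : Prop :=
  S ⊆ T.verts ∧ T.coe.IsTree ∧ Set.InjOn c T.edgeSet

/-- A family of `S`-trees is internally disjoint: pairwise edge-disjoint, and
the vertex sets of two distinct members meet exactly in `S`. -/
def InternallyDisjoint {V : Type*} {G : SimpleGraph V} (S : Set V)
    {ι : Type*} (T : ι → G.Subgraph) : Prop :=
  ∀ i j, i ≠ j → (T i).edgeSet ∩ (T j).edgeSet = ∅ ∧ (T i).verts ∩ (T j).verts = S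

/-- The coloring `c` provides, for every set `S` of `k` vertices,
`ℓ` internally disjoint rainbow `S`-trees. -/
def HasRainbowSTrees {V β : Type*} (G : SimpleGraph V) (c : Sym2 V → β) (k ℓ : ℕ) : Prop :=
  ∀ S : Finset V, S.card = k →
    ∃ T : Fin ℓ → G.Subgraph,
      (∀ i, IsRainbowSTree G c (S : Set V) (T i)) ∧ InternallyDisjoint (S : Set V) T

/-- The `(k,ℓ)`-rainbow index `rx_{k,ℓ}(G)`: the minimum number `t` of colors such that
some edge-coloring of `G` with `t` colors gives, for every `k`-set `S`,
`ℓ` internally disjoint rainbow `S`-trees. -/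
noncomputable def rainbowIndex {V : Type*} (G : SimpleGraph V) (k ℓ : ℕ) : ℕ :=
  sInf {t : ℕ | ∃ c : Sym2 V → Fin t, HasRainbowSTrees G c k ℓ}

section helpers

/-- Verts-finite subgraph which is connected with the right edge count is a rainbow tree. -/
def GoodTree {V β : Type*} (G : SimpleGraph V) (c : Sym2 V → β) (A : Set V)
    (E : Set (Sym2 V)) : Prop :=
  ∃ T : G.Subgraph, T.verts = A ∧ T.edgeSet = E ∧ T.Connected ∧ A.Finite ∧ E.Finite ∧
    A.ncard = E.ncard + 1 ∧ Set.InjOn c E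

lemma coe_edge_card {V : Type*} {G : SimpleGraph V} (T : G.Subgraph) :
    Nat.card T.coe.edgeSet = T.edgeSet.ncard := by
  rw [← T.image_coe_edgeSet_coe, Set.ncard_image_of_injective _ (Sym2.map.injective Subtype.val_injective)]
  rfl

lemma GoodTree.single {V β : Type*} (G : SimpleGraph V) (c : Sym2 V → β) (v : V) :
    GoodTree G c {v} ∅ := by
  refine ⟨G.singletonSubgraph v, rfl, by simp, Subgraph.singletonSubgraph_connected,
    Set.finite_singleton _, Set.finite_empty, by simp, by simp⟩

lemma GoodTree.leaf {V β : Type*} {G : SimpleGraph V} {c : Sym2 V → β} {A : Set V}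
    {E : Set (Sym2 V)} (h : GoodTree G c A E) {u v : V} (hu : u ∈ A) (hv : v ∉ A)
    (hadj : G.Adj u v) (hc : ∀ e ∈ E, c e ≠ c s(u, v)) :
    GoodTree G c (insert v A) (insert s(u, v) E) := by
  obtain ⟨T, rfl, rfl, hconn, hA, hE, hcard, hinj⟩ := h
  have hnot : s(u, v) ∉ T.edgeSet := fun hh => hv (T.edge_vert (T.mem_edgeSet.1 hh).symm)
  refine ⟨T ⊔ G.subgraphOfAdj hadj, ?_, ?_, ?_, hA.insert _, hE.insert _, ?_, ?_⟩
  · ext w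
    simp only [Subgraph.verts_sup, subgraphOfAdj_verts, Set.mem_union, Set.mem_insert_iff,
      Set.mem_singleton_iff]
    constructor
    · rintro (h | rfl | rfl) <;> simp_all
    · rintro (rfl | h) <;> simp_all
  · rw [Subgraph.edgeSet_sup, edgeSet_subgraphOfAdj, Set.union_singleton]
  · exact Subgraph.connected_sup hconn.preconnected
      (Subgraph.subgraphOfAdj_connected hadj).preconnected ⟨u, hu, by simp⟩
  · rw [Set.ncard_insert_of_notMem hv hA, Set.ncard_insert_of_notMem hnot hE, hcard]
  · rw [Set.injOn_insert hnot]
    refine ⟨hinj, ?_⟩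
    rintro ⟨e, he, heq⟩
    exact hc e he heq

lemma GoodTree.rainbow {V β : Type*} {G : SimpleGraph V} {c : Sym2 V → β} {A S : Set V}
    {E : Set (Sym2 V)} (h : GoodTree G c A E) (hS : S ⊆ A) :
    ∃ T : G.Subgraph, T.verts = A ∧ T.edgeSet = E ∧ IsRainbowSTree G c S T := by
  obtain ⟨T, rfl, rfl, hconn, hA, hE, hcard, hinj⟩ := h
  refine ⟨T, rfl, rfl, hS, ?_, hinj⟩
  have : Finite T.verts := hA
  rw [isTree_iff_connected_and_card, coe_edge_card]
  refine ⟨Subgraph.connected_iff'.1 hconn, ?_⟩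
  rw [← hcard]; rfl

lemma trees_of_good {V β : Type*} {G : SimpleGraph V} {c : Sym2 V → β} {S : Set V} {ℓ : ℕ}
    (A : Fin ℓ → Set V) (E : Fin ℓ → Set (Sym2 V)) (hg : ∀ i, GoodTree G c (A i) (E i))
    (hS : ∀ i, S ⊆ A i) (hA : ∀ i j, i ≠ j → ∀ v, v ∈ A i → v ∈ A j → v ∈ S)
    (hE : ∀ i j, i ≠ j → ∀ e, e ∈ E i → e ∈ E j → (∀ v ∈ e, v ∈ S) → False) :
    ∃ T : Fin ℓ → G.Subgraph,
      (∀ i, IsRainbowSTree G c S (T i)) ∧ InternallyDisjoint S T := by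
  choose T hT1 hT2 hT3 using fun i => (hg i).rainbow (hS i)
  refine ⟨T, hT3, fun i j hij => ⟨?_, ?_⟩⟩
  · rw [Set.eq_empty_iff_forall_notMem]
    rintro e ⟨h1, h2⟩
    refine hE i j hij e (hT2 i ▸ h1) (hT2 j ▸ h2) ?_
    intro v hv
    refine hA i j hij v ?_ ?_
    · rw [← hT1 i]; exact Subgraph.mem_verts_of_mem_edge h1 hv
    · rw [← hT1 j]; exact Subgraph.mem_verts_of_mem_edge h2 hv
  · rw [hT1, hT1]
    ext v
    exact ⟨fun h => hA i j hij v h.1 h.2, fun h => ⟨hS i h, hS j h⟩⟩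

lemma rainbow_mono {V β : Type*} {G : SimpleGraph V} {c : Sym2 V → β} {k ℓ m : ℕ} (h : ℓ ≤ m)
    (H : HasRainbowSTrees G c k m) : HasRainbowSTrees G c k ℓ := by
  intro S hS
  obtain ⟨T, h1, h2⟩ := H S hS
  refine ⟨fun i => T (Fin.castLE h i), fun i => h1 _, fun i j hij => h2 _ _ ?_⟩
  intro hh
  exact hij (Fin.castLE_injective h hh)

/-- Rainbow trees in `t` colours have at most `t + 1` vertices. -/
lemma verts_le {V : Type*} [Finite V] {G : SimpleGraph V} {t : ℕ} {c : Sym2 V → Fin t} {S : Set V}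
    {T : G.Subgraph} (h : IsRainbowSTree G c S T) : T.verts.ncard ≤ t + 1 := by
  obtain ⟨-, h2, h3⟩ := h
  have h4 := (isTree_iff_connected_and_card.1 h2).2
  rw [coe_edge_card] at h4
  have h5 : T.edgeSet.ncard ≤ t := by
    have := Set.ncard_le_ncard_of_injOn (t := (Set.univ : Set (Fin t))) c (fun _ _ => Set.mem_univ _) h3
    simpa [Set.ncard_univ] using this
  have h6 : Nat.card T.verts = T.verts.ncard := rfl
  omega

lemma exists_nbr {V : Type*} {G : SimpleGraph V} {T : G.Subgraph} (h : T.coe.IsTree)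
    {a b : V} (ha : a ∈ T.verts) (hb : b ∈ T.verts) (hab : a ≠ b) : ∃ x, T.Adj a x := by
  have : Nontrivial T.verts := ⟨⟨a, ha⟩, ⟨b, hb⟩, fun hh => hab (congrArg Subtype.val hh)⟩
  obtain ⟨x, hx⟩ := h.1.preconnected.exists_adj_of_nontrivial ⟨a, ha⟩
  exact ⟨x, hx⟩

/-- lower bound 3 -/
lemma lower3 {r n t ℓ : ℕ} (hr : 0 < r) (hn : 3 ≤ n) (hℓ : 1 ≤ ℓ)
    (c : Sym2 (Σ _ : Fin r, Fin n) → Fin t)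
    (H : HasRainbowSTrees (completeMultipartiteGraph (fun _ : Fin r => Fin n)) c 3 ℓ) : 3 ≤ t := by
  classical
  let f : Fin 3 → (Σ _ : Fin r, Fin n) := fun k => ⟨⟨0, hr⟩, Fin.castLE hn k⟩
  have hf : Function.Injective f := by
    intro x y hxy
    simpa [f] using hxy
  obtain ⟨T, h1, -⟩ := H (Finset.univ.image f) (by rw [Finset.card_image_of_injective _ hf]; simp)
  have h := h1 ⟨0, hℓ⟩
  set T0 := T ⟨0, hℓ⟩
  have hmem : ∀ k, f k ∈ T0.verts := fun k => h.1 (by simp)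
  obtain ⟨x, hx⟩ := exists_nbr h.2.1 (hmem 0) (hmem 1) (fun hh => by simpa using hf hh)
  have hx1 := T0.adj_sub hx
  have hxS : x ∉ (Finset.univ.image f : Set (Σ _ : Fin r, Fin n)) := by
    rintro hh
    simp only [Finset.mem_coe, Finset.mem_image, Finset.mem_univ, true_and] at hh
    obtain ⟨k, rfl⟩ := hh
    simp [f] at hx1
  have h4 := verts_le h
  have h5 : (insert x (Finset.univ.image f : Set (Σ _ : Fin r, Fin n))) ⊆ T0.verts := by
    rw [Set.insert_subset_iff]
    exact ⟨T0.edge_vert hx.symm, h.1⟩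
  have h6 := Set.ncard_le_ncard h5 (Set.toFinite _)
  rw [Set.ncard_insert_of_notMem hxS (Set.toFinite _), Set.ncard_coe_finset,
    Finset.card_image_of_injective _ hf] at h6
  simp at h6
  omega

/-- lower bound 4 -/
lemma lower4 {n t ℓ : ℕ} (hn : 1 ≤ n) (hℓ : 4 ≤ ℓ)
    (c : Sym2 (Σ _ : Fin 3, Fin n) → Fin t)
    (H : HasRainbowSTrees (completeMultipartiteGraph (fun _ : Fin 3 => Fin n)) c 3 ℓ) : 4 ≤ t := by
  classical
  by_contra! ht
  let f : Fin 3 → (Σ _ : Fin 3, Fin n) := fun k => ⟨k, ⟨0, hn⟩⟩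
  have hf : Function.Injective f := by
    intro x y hxy
    simpa [f] using hxy
  obtain ⟨T, h1, h2⟩ := H (Finset.univ.image f) (by rw [Finset.card_image_of_injective _ hf]; simp)
  have key : ∀ i, ∃ k : Fin 3, (T i).Adj (f k) (f (k + 1)) := by
    intro i
    by_contra! hno
    have hno' : ∀ k l, ¬ (T i).Adj (f k) (f l) := by
      intro k l hkl
      have hne : k ≠ l := by rintro rfl; exact (T i).adj_sub hkl |>.ne rfl
      have : l = k + 1 ∨ k = l + 1 := by
        clear hkl; revert k l; decide
      rcases this with rfl | rfl
      · exact hno _ hkl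
      · exact hno _ hkl.symm
    have h := h1 i
    have hmem : ∀ k, f k ∈ (T i).verts := fun k => h.1 (by simp)
    have hn' : ∀ k, ∃ x, (T i).Adj (f k) x := fun k =>
      exists_nbr h.2.1 (hmem k) (hmem (k + 1)) (fun hh => by
        have := hf hh; clear hh; revert this; revert k; decide)
    choose x hx using hn'
    have hxS : ∀ k, x k ∉ (Finset.univ.image f : Set (Σ _ : Fin 3, Fin n)) := by
      rintro k hh
      simp only [Finset.mem_coe, Finset.mem_image, Finset.mem_univ, true_and] at hh
      obtain ⟨l, hl⟩ := hh
      exact hno' k l (hl ▸ hx k)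
    have hxeq : ∀ k l, x k = x l := by
      intro k l
      by_contra hkl
      have h5 : (insert (x k) (insert (x l) (Finset.univ.image f : Set (Σ _ : Fin 3, Fin n))))
          ⊆ (T i).verts := by
        rw [Set.insert_subset_iff, Set.insert_subset_iff]
        exact ⟨(T i).edge_vert (hx k).symm, (T i).edge_vert (hx l).symm, h.1⟩
      have h6 := Set.ncard_le_ncard h5 (Set.toFinite _)
      rw [Set.ncard_insert_of_notMem (by simp only [Set.mem_insert_iff, hkl, hxS, or_self, not_false_eq_true]) (Set.toFinite _),
        Set.ncard_insert_of_notMem (hxS l) (Set.toFinite _), Set.ncard_coe_finset,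
        Finset.card_image_of_injective _ hf] at h6
      simp at h6
      have := verts_le h
      omega
    have h7 := (T i).adj_sub (hx (x 0).1)
    rw [hxeq (x 0).1 0] at h7
    simp [f] at h7
  choose k hk using key
  have hkinj : Function.Injective k := by
    intro i j hij
    by_contra hne
    have := (h2 i j hne).1
    rw [Set.eq_empty_iff_forall_notMem] at this
    refine this s(f (k i), f (k i + 1)) ⟨hk i, ?_⟩
    rw [hij]; exact hk j
  have := Fintype.card_le_of_injective k hkinj
  simp at this
  omega

end helpers
section coloring

/-- Paley tournament on residues mod 19. -/
def Beats (p q : ℕ) : Prop := (q % 19 + 19 - p % 19) % 19 ∈ [1, 4, 5, 6, 7, 9, 11, 16, 17]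

instance : DecidableRel Beats := fun _ _ => by unfold Beats; infer_instance

lemma beats_zero : ∀ q2 < 19, ∀ q3 < 19, ∃ p < 19, Beats p 0 ∧ Beats p q2 ∧ Beats p q3 := by
  decide +kernel

lemma beats_three (q1 q2 q3 : ℕ) : ∃ p < 19, Beats p q1 ∧ Beats p q2 ∧ Beats p q3 := by
  obtain ⟨p, hp, h1, h2, h3⟩ := beats_zero ((q2 % 19 + 19 - q1 % 19) % 19) (Nat.mod_lt _ (by norm_num))
    ((q3 % 19 + 19 - q1 % 19) % 19) (Nat.mod_lt _ (by norm_num))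
  refine ⟨(p + q1) % 19, Nat.mod_lt _ (by norm_num), ?_, ?_, ?_⟩
  · unfold Beats at *
    convert h1 using 1
    omega
  · unfold Beats at *
    convert h2 using 1
    omega
  · unfold Beats at *
    convert h3 using 1
    omega

lemma beats_asymm {p q : ℕ} (h : Beats p q) : ¬ Beats q p := by
  unfold Beats at *
  simp only [List.mem_cons, List.not_mem_nil, or_false] at *
  omega

lemma beats_congr {p p' q : ℕ} (h : p % 19 = p' % 19) : Beats p q ↔ Beats p' q := by
  unfold Beats
  rw [h]

/-- A small family of hash functions realising all patterns on triples. -/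
lemma hash_family {V : Type*} [Fintype V] {t M K L : ℕ} (ht : 0 < t) (hK0 : K ≠ 0) (hK : Fintype.card V ≤ 2 ^ K)
    (hL : M * (K ^ 3 * t ^ 8) ≤ L) :
    ∃ h : ℕ → V → Fin t, ∀ (a b d : V) (g : V → Fin t), ∃ F : Finset ℕ, M ≤ F.card ∧
      ∀ x ∈ F, x < L ∧ h x a = g a ∧ h x b = g b ∧ h x d = g d := by
  classical
  obtain ⟨lab⟩ : Nonempty (V ↪ (Fin K → Bool)) :=
    Function.Embedding.nonempty_of_card_le (by simpa using hK)
  let I := Fin M × ((Fin K × Fin K × Fin K) × (Bool × Bool × Bool → Fin t))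
  have hI : Fintype.card I = M * (K ^ 3 * t ^ 8) := by
    simp only [I, Fintype.card_prod, Fintype.card_fin, Fintype.card_fun, Fintype.card_bool]
    ring
  let e : I ≃ Fin (M * (K ^ 3 * t ^ 8)) := Fintype.equivFinOfCardEq hI
  let hh : I → V → Fin t := fun x v =>
    x.2.2 (lab v x.2.1.1, lab v x.2.1.2.1, lab v x.2.1.2.2)
  refine ⟨fun x v => if hx : x < M * (K ^ 3 * t ^ 8) then hh (e.symm ⟨x, hx⟩) v else ⟨0, ht⟩, ?_⟩
  intro a b d g
  by_cases hM : M = 0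
  · exact ⟨∅, by simp [hM], by simp⟩
  have sep : ∀ u v : V, ∃ p : Fin K, u ≠ v → lab u p ≠ lab v p := by
    intro u v
    by_cases huv : u = v
    · exact ⟨⟨0, Nat.pos_of_ne_zero hK0⟩, fun h => absurd huv h⟩
    · have : lab u ≠ lab v := fun h => huv (lab.injective h)
      obtain ⟨p, hp⟩ := Function.ne_iff.1 this
      exact ⟨p, fun _ => hp⟩
  obtain ⟨p, hp⟩ := sep a b
  obtain ⟨q, hq⟩ := sep a d
  obtain ⟨s, hs⟩ := sep b d
  let β : V → Bool × Bool × Bool := fun v => (lab v p, lab v q, lab v s)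
  let φ : Bool × Bool × Bool → Fin t := fun z =>
    if z = β a then g a else if z = β b then g b else g d
  have h1 : φ (β a) = g a := by simp [φ]
  have h2 : φ (β b) = g b := by
    by_cases hab : b = a
    · rw [hab, h1]
    · have : β b ≠ β a := fun hh => hp (Ne.symm hab) (congrArg Prod.fst hh).symm
      simp [φ, this]
  have h3 : φ (β d) = g d := by
    by_cases hab : d = a
    · rw [hab, h1]
    by_cases hbd : d = b
    · rw [hbd, h2]
    · have h4 : β d ≠ β a := fun hh => hq (Ne.symm hab) (congrArg (fun z => z.2.1) hh).symm
      have h5 : β d ≠ β b := fun hh => hs (Ne.symm hbd) (congrArg (fun z => z.2.2) hh).symm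
      simp [φ, h4, h5]
  let ix : Fin M → ℕ := fun m => (e (m, ((p, q, s), φ)) : ℕ)
  have hix : Function.Injective ix := by
    intro m m' hmm
    have := e.injective (Fin.ext hmm)
    exact congrArg Prod.fst this
  refine ⟨Finset.univ.image ix, by rw [Finset.card_image_of_injective _ hix]; simp, ?_⟩
  intro x hx
  simp only [Finset.mem_image, Finset.mem_univ, true_and] at hx
  obtain ⟨m, rfl⟩ := hx
  have hlt : ix m < M * (K ^ 3 * t ^ 8) := (e (m, ((p, q, s), φ))).2
  have hv : ∀ v, hh (e.symm ⟨ix m, hlt⟩) v = φ (β v) := by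
    intro v
    have : (⟨ix m, hlt⟩ : Fin _) = e (m, ((p, q, s), φ)) := rfl
    rw [this, e.symm_apply_apply]
  refine ⟨lt_of_lt_of_le hlt hL, ?_, ?_, ?_⟩
  · simp only [hlt, dif_pos]; rw [hv, h1]
  · simp only [hlt, dif_pos]; rw [hv, h2]
  · simp only [hlt, dif_pos]; rw [hv, h3]

/-- The colouring realises all patterns. -/
def Universal {r n t : ℕ} (c : Sym2 (Σ _ : Fin r, Fin n) → Fin t) (M : ℕ) : Prop :=
  ∀ (i : Fin r) (a b d : Σ _ : Fin r, Fin n), a.1 ≠ i → b.1 ≠ i → d.1 ≠ i →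
    ∀ g : (Σ _ : Fin r, Fin n) → Fin t, ∃ F : Finset (Fin n), M ≤ F.card ∧
      ∀ j ∈ F, c s(⟨i, j⟩, a) = g a ∧ c s(⟨i, j⟩, b) = g b ∧ c s(⟨i, j⟩, d) = g d

lemma universal_of_bound {r n t M K : ℕ} (ht : 0 < t) (hK0 : K ≠ 0) (hK : r * n ≤ 2 ^ K)
    (hL : 19 * (M * (K ^ 3 * t ^ 8)) ≤ n) :
    ∃ c : Sym2 (Σ _ : Fin r, Fin n) → Fin t, Universal c M := by
  classical
  obtain ⟨h, hh⟩ := hash_family (V := Σ _ : Fin r, Fin n) (M := M) ht hK0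
    (by simpa using hK) (le_refl (M * (K ^ 3 * t ^ 8)))
  let f : (Σ _ : Fin r, Fin n) → (Σ _ : Fin r, Fin n) → Fin t := fun v w =>
    if Beats v.2 w.2 then h (v.2 / 19) w else if Beats w.2 v.2 then h (w.2 / 19) v else ⟨0, ht⟩
  have hf : ∀ v w, f v w = f w v := by
    intro v w
    simp only [f]
    by_cases h1 : Beats v.2 w.2
    · simp [h1, beats_asymm h1]
    · simp [h1]
  refine ⟨Sym2.lift ⟨f, hf⟩, ?_⟩
  intro i a b d _ _ _ g
  obtain ⟨F, hF1, hF2⟩ := hh a b d g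
  obtain ⟨p, hp, hpa, hpb, hpd⟩ := beats_three a.2 b.2 d.2
  have hlt : ∀ x : F, 19 * x.1 + p < n := fun x => by
    have := (hF2 x.1 x.2).1
    omega
  let ix : F → Fin n := fun x => ⟨19 * x.1 + p, hlt x⟩
  have hix : Function.Injective ix := by
    intro x y hxy
    have := congrArg Fin.val hxy
    simp only [ix] at this
    exact Subtype.ext (by omega)
  refine ⟨Finset.univ.image ix, by rw [Finset.card_image_of_injective _ hix]; simpa using hF1, ?_⟩
  intro j hj
  simp only [Finset.mem_image, Finset.mem_univ, true_and] at hj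
  obtain ⟨x, rfl⟩ := hj
  have hb : ∀ q, Beats p q → Beats (19 * x.1 + p) q := fun q hq =>
    (beats_congr (by omega)).1 hq
  have hdiv : (19 * x.1 + p) / 19 = x.1 := by omega
  obtain ⟨-, e1, e2, e3⟩ := hF2 x.1 x.2
  refine ⟨?_, ?_, ?_⟩
  · simp only [Sym2.lift_mk, f, ix, hb _ hpa, if_true, hdiv, e1]
  · simp only [Sym2.lift_mk, f, ix, hb _ hpb, if_true, hdiv, e2]
  · simp only [Sym2.lift_mk, f, ix, hb _ hpd, if_true, hdiv, e3]

lemma growth (r C : ℕ) : ∃ N, ∀ n, N ≤ n → ∃ K, K ≠ 0 ∧ r * n ≤ 2 ^ K ∧ C * K ^ 3 ≤ n := by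
  have h := tendsto_pow_const_div_const_pow_of_one_lt 3 (r := (2 : ℝ)) (by norm_num)
  have h2 : ∀ᶠ k : ℕ in Filter.atTop, ((k : ℝ) ^ 3 / 2 ^ k) < 1 / (2 * (r + 1) * (C + 1)) :=
    h.eventually_lt_const (by positivity)
  obtain ⟨K0, hK0⟩ := Filter.eventually_atTop.1 h2
  refine ⟨2 ^ K0 + 1, fun n hn => ?_⟩
  have hn0 : (r + 1) * n ≠ 0 := by
    have : 0 < n := by
      have := Nat.zero_le (2 ^ K0)
      linarith
    positivity
  refine ⟨Nat.log 2 ((r + 1) * n) + 1, by omega, ?_, ?_⟩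
  · have := Nat.lt_pow_succ_log_self (b := 2) (by norm_num) ((r + 1) * n)
    calc r * n ≤ (r + 1) * n := Nat.mul_le_mul_right _ (by omega)
      _ ≤ _ := this.le
  · set k := Nat.log 2 ((r + 1) * n) with hk
    have h3 : 2 ^ k ≤ (r + 1) * n := Nat.pow_log_le_self 2 hn0
    have h4 : K0 ≤ k + 1 := by
      have : K0 ≤ k := by
        apply (Nat.le_log_iff_pow_le (by norm_num) hn0).2
        nlinarith
      omega
    have h5 := hK0 (k + 1) h4
    rw [div_lt_div_iff₀ (by positivity) (by positivity)] at h5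
    have h6 : (k + 1) ^ 3 * (2 * (r + 1) * (C + 1)) < 1 * 2 ^ (k + 1) := by exact_mod_cast h5
    have h7 : (k + 1) ^ 3 * (C + 1) * (r + 1) < n * (r + 1) := by
      rw [pow_succ 2 k] at h6
      nlinarith
    have h8 := Nat.lt_of_mul_lt_mul_right h7
    nlinarith [Nat.zero_le ((k + 1) ^ 3)]

lemma exists_universal (r t M : ℕ) (ht : 0 < t) :
    ∃ N, ∀ n, N ≤ n → ∃ c : Sym2 (Σ _ : Fin r, Fin n) → Fin t, Universal c M := by
  obtain ⟨N, hN⟩ := growth r (19 * (M * t ^ 8))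
  refine ⟨N, fun n hn => ?_⟩
  obtain ⟨K, h1, h2, h3⟩ := hN n hn
  exact universal_of_bound ht h1 h2 (by linarith [h3, show 19 * (M * (K ^ 3 * t ^ 8)) = 19 * (M * t ^ 8) * K ^ 3 by ring])

end coloring
section upper

variable {r n t : ℕ} {c : Sym2 (Σ _ : Fin r, Fin n) → Fin t} {M : ℕ}

lemma Universal.three (hc : Universal c M) (i : Fin r) {a b d : Σ _ : Fin r, Fin n} (ha : a.1 ≠ i)
    (hb : b.1 ≠ i) (hd : d.1 ≠ i) (hab : a ≠ b) (had : a ≠ d) (hbd : b ≠ d) (α β γ : Fin t) :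
    ∃ F : Finset (Fin n), M ≤ F.card ∧
      ∀ j ∈ F, c s(⟨i, j⟩, a) = α ∧ c s(⟨i, j⟩, b) = β ∧ c s(⟨i, j⟩, d) = γ := by
  classical
  obtain ⟨F, h1, h2⟩ := hc i a b d ha hb hd (fun v => if v = a then α else if v = b then β else γ)
  refine ⟨F, h1, fun j hj => ?_⟩
  simpa [hab.symm, had.symm, hbd.symm] using h2 j hj

lemma Universal.two (hc : Universal c M) (i : Fin r) {a b : Σ _ : Fin r, Fin n} (ha : a.1 ≠ i)
    (hb : b.1 ≠ i) (hab : a ≠ b) (α β : Fin t) :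
    ∃ F : Finset (Fin n), M ≤ F.card ∧
      ∀ j ∈ F, c s(⟨i, j⟩, a) = α ∧ c s(⟨i, j⟩, b) = β := by
  classical
  obtain ⟨F, h1, h2⟩ := hc i a b b ha hb hb (fun v => if v = a then α else β)
  refine ⟨F, h1, fun j hj => ?_⟩
  have := h2 j hj
  simp [hab.symm] at this
  exact this

lemma choose_distinct {ℓ n : ℕ} (F : Fin ℓ → Finset (Fin n)) (hF : ∀ s, ℓ ≤ (F s).card) :
    ∃ f : Fin ℓ → Fin n, Function.Injective f ∧ ∀ s, f s ∈ F s := by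
  classical
  rw [← Finset.all_card_le_biUnion_card_iff_exists_injective]
  intro s
  rcases s.eq_empty_or_nonempty with rfl | ⟨x, hx⟩
  · simp
  · calc s.card ≤ ℓ := by simpa using Finset.card_le_univ s
      _ ≤ (F x).card := hF x
      _ ≤ _ := Finset.card_le_card (Finset.subset_biUnion_of_mem F hx)

lemma cm_adj {v w : Σ _ : Fin r, Fin n} (h : v.1 ≠ w.1) :
    (completeMultipartiteGraph (fun _ : Fin r => Fin n)).Adj v w := h

lemma upper_star {ℓ : ℕ} (hc : Universal c M) (hM : ℓ ≤ M) (ht : 3 ≤ t) (i : Fin r)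
    {a b d : Σ _ : Fin r, Fin n} (ha : a.1 ≠ i)
    (hb : b.1 ≠ i) (hd : d.1 ≠ i) (hab : a ≠ b) (had : a ≠ d) (hbd : b ≠ d) :
    ∃ T : Fin ℓ → (completeMultipartiteGraph (fun _ : Fin r => Fin n)).Subgraph,
      (∀ k, IsRainbowSTree _ c {a, b, d} (T k)) ∧ InternallyDisjoint {a, b, d} T := by
  obtain ⟨F, hF1, hF2⟩ := hc.three i ha hb hd hab had hbd ⟨0, by omega⟩ ⟨1, by omega⟩ ⟨2, by omega⟩
  obtain ⟨f, hf1, hf2⟩ := choose_distinct (ℓ := ℓ) (fun _ => F) (fun _ => hM.trans hF1)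
  have hxa : ∀ k, a ≠ ⟨i, f k⟩ := fun k h => ha (by have h' := congrArg Sigma.fst h; exact h')
  have hxb : ∀ k, b ≠ ⟨i, f k⟩ := fun k h => hb (by have h' := congrArg Sigma.fst h; exact h')
  have hxd : ∀ k, d ≠ ⟨i, f k⟩ := fun k h => hd (by have h' := congrArg Sigma.fst h; exact h')
  have hxx : ∀ k l, k ≠ l → (⟨i, f k⟩ : Σ _ : Fin r, Fin n) ≠ ⟨i, f l⟩ := by
    intro k l hkl h
    apply hkl
    apply hf1
    simpa using h
  refine trees_of_good
    (fun k => {d, b, a, ⟨i, f k⟩})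
    (fun k => {s(⟨i, f k⟩, d), s(⟨i, f k⟩, b), s(⟨i, f k⟩, a)}) ?_ ?_ ?_ ?_
  · intro k
    obtain ⟨c1, c2, c3⟩ := hF2 _ (hf2 k)
    have g0 := GoodTree.single (completeMultipartiteGraph (fun _ : Fin r => Fin n)) c ⟨i, f k⟩
    have g1 := g0.leaf (u := ⟨i, f k⟩) (v := a) (by simp) (by simpa using hxa k)
      (cm_adj ha.symm) (by simp)
    have g2 := g1.leaf (u := ⟨i, f k⟩) (v := b) (by simp) (by simp [hxb k, hab.symm])
      (cm_adj hb.symm) (by simp [c1, c2])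
    have g3 := g2.leaf (u := ⟨i, f k⟩) (v := d) (by simp) (by simp [hxd k, had.symm, hbd.symm])
      (cm_adj hd.symm) (by simp [c1, c2, c3])
    simpa using g3
  · intro k v hv
    simp only [Set.mem_insert_iff, Set.mem_singleton_iff] at hv ⊢
    tauto
  · intro k l hkl v hv hv'
    have := hxx k l hkl
    simp only [Set.mem_insert_iff, Set.mem_singleton_iff] at hv hv' ⊢
    grind
  · intro k l hkl e he he' hS
    have : (⟨i, f k⟩ : Σ _ : Fin r, Fin n) ∈ e := by
      simp only [Set.mem_insert_iff, Set.mem_singleton_iff] at he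
      rcases he with rfl | rfl | rfl <;> simp
    have := hS _ this
    simp only [Set.mem_insert_iff, Set.mem_singleton_iff] at this
    rcases this with h | h | h
    · exact hxa k h.symm
    · exact hxb k h.symm
    · exact hxd k h.symm

/-- Path `p - q - x - s` with `x` in the class of `p`. -/
lemma path_tree (hc : Universal c 2) {p q s : Σ _ : Fin r, Fin n} (hpq : p.1 ≠ q.1)
    (hps : p.1 ≠ s.1) (hqs : q.1 ≠ s.1) (ht : 3 ≤ t) :
    ∃ x : Σ _ : Fin r, Fin n, x.1 = p.1 ∧ x ≠ p ∧
      GoodTree (completeMultipartiteGraph (fun _ : Fin r => Fin n)) c {s, x, q, p}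
        {s(x, s), s(q, x), s(p, q)} := by
  classical
  obtain ⟨α, hα⟩ : ∃ α : Fin t, α ≠ c s(p, q) := by
    by_contra! h
    have h1 := h ⟨0, by omega⟩
    have h2 := h ⟨1, by omega⟩
    simpa using h1.trans h2.symm
  obtain ⟨β, hβ, hβα⟩ : ∃ β : Fin t, β ≠ c s(p, q) ∧ β ≠ α := by
    have : ((({c s(p, q), α} : Finset (Fin t))ᶜ).Nonempty) := by
      rw [← Finset.card_pos, Finset.card_compl]
      have := Finset.card_le_two (a := c s(p, q)) (b := α)
      simp only [Fintype.card_fin]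
      omega
    obtain ⟨β, hβ⟩ := this
    simp at hβ
    exact ⟨β, hβ.1, hβ.2⟩
  have hqs' : q ≠ s := fun h => hqs (congrArg _ h)
  obtain ⟨F, hF1, hF2⟩ := hc.two p.1 hpq.symm hps.symm hqs' α β
  obtain ⟨j, hj, hjp⟩ := Finset.exists_mem_ne (s := F) (by omega) p.2
  obtain ⟨c1, c2⟩ := hF2 j hj
  have hxp : (⟨p.1, j⟩ : Σ _ : Fin r, Fin n) ≠ p := by
    intro h
    apply hjp
    rw [← h]
  refine ⟨⟨p.1, j⟩, rfl, hxp, ?_⟩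
  have hpq' : q ≠ p := fun h => hpq (congrArg _ h.symm)
  have hps' : s ≠ p := fun h => hps (congrArg _ h.symm)
  have hxq : (⟨p.1, j⟩ : Σ _ : Fin r, Fin n) ≠ q := fun h => hpq (by have h' := congrArg Sigma.fst h; exact h')
  have hxs : s ≠ (⟨p.1, j⟩ : Σ _ : Fin r, Fin n) := fun h => hps (by have h' := congrArg Sigma.fst h.symm; exact h')
  rw [Sym2.eq_swap] at c1
  have g0 := GoodTree.single (completeMultipartiteGraph (fun _ : Fin r => Fin n)) c p
  have g1 := g0.leaf (u := p) (v := q) (by simp) (by simpa using hpq')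
    (cm_adj hpq) (by simp)
  have g2 := g1.leaf (u := q) (v := ⟨p.1, j⟩) (by simp) (by simp [hxp, hxq])
    (cm_adj hpq.symm) (by simp [c1, hα.symm])
  have g3 := g2.leaf (u := ⟨p.1, j⟩) (v := s) (by simp) (by simp [hxs, hqs'.symm, hps'])
    (cm_adj hps) (by simp [c1, c2, hβ.symm, hβα.symm])
  simpa using g3

lemma upper_three (hc : Universal c 2) (ht : 3 ≤ t)
    {a b d : Σ _ : Fin r, Fin n} (hab : a.1 ≠ b.1) (had : a.1 ≠ d.1) (hbd : b.1 ≠ d.1) :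
    ∃ T : Fin 3 → (completeMultipartiteGraph (fun _ : Fin r => Fin n)).Subgraph,
      (∀ k, IsRainbowSTree _ c {a, b, d} (T k)) ∧ InternallyDisjoint {a, b, d} T := by
  obtain ⟨x, hx1, hx2, hx3⟩ := path_tree hc hab had hbd ht
  obtain ⟨y, hy1, hy2, hy3⟩ := path_tree hc hbd hab.symm had.symm ht
  obtain ⟨z, hz1, hz2, hz3⟩ := path_tree hc had.symm hbd.symm hab ht
  have hxy : x ≠ y := fun h => hab (by rw [← hx1, ← hy1, h])
  have hxz : x ≠ z := fun h => had (by rw [← hx1, ← hz1, h])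
  have hyz : y ≠ z := fun h => hbd (by rw [← hy1, ← hz1, h])
  have hab' : a ≠ b := fun h => hab (congrArg _ h)
  have had' : a ≠ d := fun h => had (congrArg _ h)
  have hbd' : b ≠ d := fun h => hbd (congrArg _ h)
  have hxb : x ≠ b := fun h => hab (by rw [← hx1, h])
  have hxd : x ≠ d := fun h => had (by rw [← hx1, h])
  have hya : y ≠ a := fun h => hab (by rw [← hy1, h])
  have hyd : y ≠ d := fun h => hbd (by rw [← hy1, h])
  have hza : z ≠ a := fun h => had (by rw [← hz1, h])
  have hzb : z ≠ b := fun h => hbd (by rw [← hz1, h])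
  let w : Fin 3 → (Σ _ : Fin r, Fin n) := ![x, y, z]
  let P : Fin 3 → (Σ _ : Fin r, Fin n) := ![a, b, d]
  have hw : Function.Injective w := by
    intro k l h
    fin_cases k <;> fin_cases l <;> simp_all [w]
  have hP : Function.Injective P := by
    intro k l h
    fin_cases k <;> fin_cases l <;> simp_all [P]
  have hwP : ∀ k l, w k ≠ P l := by
    intro k l
    fin_cases k <;> fin_cases l <;> simp_all [w, P]
  have hS : ({a, b, d} : Set (Σ _ : Fin r, Fin n)) = Set.range P := by
    ext v
    simp [P, eq_comm]
    tauto
  have hsub : ∀ k, Set.range P = {P (k + 2), P (k + 1), P k} := by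
    intro k
    rw [← hS]
    ext v
    fin_cases k <;> simp [P] <;> tauto
  rw [hS]
  refine trees_of_good
    (fun k => {P (k + 2), w k, P (k + 1), P k})
    (fun k => {s(w k, P (k + 2)), s(P (k + 1), w k), s(P k, P (k + 1))}) ?_ ?_ ?_ ?_
  · intro k
    fin_cases k
    · exact hx3
    · exact hy3
    · exact hz3
  · intro k v hv
    rw [hsub k] at hv
    simp only [Set.mem_insert_iff, Set.mem_singleton_iff] at hv ⊢
    tauto
  · intro k l hkl v hv hv'
    simp only [Set.mem_insert_iff, Set.mem_singleton_iff] at hv hv'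
    rcases hv with rfl | rfl | rfl | rfl
    · simp
    · have : w k ≠ w l := fun h => hkl (hw h)
      simp [hwP, this] at hv'
    · simp
    · simp
  · intro k l hkl e he he' hS'
    have hno : ∀ m, w m ∉ e := fun m hm => by
      obtain ⟨u, hu⟩ := hS' _ hm
      exact hwP m u hu.symm
    have key : ∀ m, e ∈ ({s(w m, P (m + 2)), s(P (m + 1), w m), s(P m, P (m + 1))} : Set (Sym2 _)) →
        e = s(P m, P (m + 1)) := by
      intro m hm
      simp only [Set.mem_insert_iff, Set.mem_singleton_iff] at hm
      rcases hm with rfl | rfl | rfl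
      · exact absurd (by simp) (hno m)
      · exact absurd (by simp) (hno m)
      · rfl
    have h1 := key k he
    have h2 := key l he'
    rw [h1, Sym2.eq_iff, hP.eq_iff, hP.eq_iff, hP.eq_iff, hP.eq_iff] at h2
    clear * - h2 hkl
    revert k l
    decide

lemma upper_four {ℓ : ℕ} (hc : Universal c (ℓ + 1)) (ht : 4 ≤ t)
    {a b d : Σ _ : Fin r, Fin n} (hab : a.1 ≠ b.1) (had : a.1 ≠ d.1) (hbd : b.1 ≠ d.1) :
    ∃ T : Fin ℓ → (completeMultipartiteGraph (fun _ : Fin r => Fin n)).Subgraph,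
      (∀ k, IsRainbowSTree _ c {a, b, d} (T k)) ∧ InternallyDisjoint {a, b, d} T := by
  classical
  have hab' : a ≠ b := fun h => hab (congrArg _ h)
  have had' : a ≠ d := fun h => had (congrArg _ h)
  have hbd' : b ≠ d := fun h => hbd (congrArg _ h)
  obtain ⟨F, hF1, hF2⟩ := hc.two a.1 hab.symm had.symm hbd' ⟨0, by omega⟩ ⟨1, by omega⟩
  obtain ⟨f, hf1, hf2⟩ := choose_distinct (ℓ := ℓ) (fun _ => F.erase a.2) (fun _ => by
    have := Finset.pred_card_le_card_erase (s := F) (a := a.2)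
    omega)
  let x : Fin ℓ → (Σ _ : Fin r, Fin n) := fun k => ⟨a.1, f k⟩
  have hxa : ∀ k, x k ≠ a := fun k h => by
    have := hf2 k
    simp only [Finset.mem_erase] at this
    apply this.1
    rw [← h]
  have hG := fun k => hc.two (a := x k) (b := a) b.1 hab hab (hxa k) ⟨3, by omega⟩ ⟨2, by omega⟩
  choose G hG1 hG2 using hG
  obtain ⟨g, hg1, hg2⟩ := choose_distinct (ℓ := ℓ) (fun k => (G k).erase b.2) (fun k => by
    have := Finset.pred_card_le_card_erase (s := G k) (a := b.2)
    have := hG1 k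
    omega)
  let y : Fin ℓ → (Σ _ : Fin r, Fin n) := fun k => ⟨b.1, g k⟩
  have hyb : ∀ k, y k ≠ b := fun k h => by
    have := hg2 k
    simp only [Finset.mem_erase] at this
    apply this.1
    rw [← h]
  have hx : Function.Injective x := by
    intro k l h
    apply hf1
    simpa [x] using h
  have hy : Function.Injective y := by
    intro k l h
    apply hg1
    simpa [y] using h
  have hxy : ∀ k l, x k ≠ y l := fun k l h => hab (by have h' := congrArg Sigma.fst h; exact h')
  have hxb : ∀ k, x k ≠ b := fun k h => hab (by have h' := congrArg Sigma.fst h; exact h')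
  have hxd : ∀ k, x k ≠ d := fun k h => had (by have h' := congrArg Sigma.fst h; exact h')
  have hya : ∀ k, y k ≠ a := fun k h => hab (by have h' := congrArg Sigma.fst h; exact h'.symm)
  have hyd : ∀ k, y k ≠ d := fun k h => hbd (by have h' := congrArg Sigma.fst h; exact h')
  refine trees_of_good
    (fun k => {a, y k, d, b, x k})
    (fun k => {s(y k, a), s(x k, y k), s(x k, d), s(x k, b)}) ?_ ?_ ?_ ?_
  · intro k
    obtain ⟨c1, c2⟩ := hF2 _ (Finset.mem_of_mem_erase (hf2 k))
    obtain ⟨c3, c4⟩ := hG2 k _ (Finset.mem_of_mem_erase (hg2 k))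
    change c s(x k, b) = _ at c1
    change c s(x k, d) = _ at c2
    change c s(y k, x k) = _ at c3
    change c s(y k, a) = _ at c4
    rw [Sym2.eq_swap] at c3
    have g0 := GoodTree.single (completeMultipartiteGraph (fun _ : Fin r => Fin n)) c (x k)
    have g1 := g0.leaf (u := x k) (v := b) (by simp) (by simpa using (hxb k).symm)
      (cm_adj hab) (by simp)
    have g2 := g1.leaf (u := x k) (v := d) (by simp) (by simp [(hxd k).symm, hbd'.symm])
      (cm_adj had) (by simp [c1, c2])
    have g3 := g2.leaf (u := x k) (v := y k) (by simp) (by simp [(hxy k k).symm, hyb, hyd])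
      (cm_adj hab) (by simp [c1, c2, c3])
    have g4 := g3.leaf (u := y k) (v := a) (by simp)
      (by simp [(hxa k).symm, (hya k).symm, hab', had'])
      (cm_adj hab.symm) (by simp [c1, c2, c3, c4])
    simpa using g4
  · intro k v hv
    simp only [Set.mem_insert_iff, Set.mem_singleton_iff] at hv ⊢
    tauto
  · intro k l hkl v hv hv'
    have h1 : x k ≠ x l := fun h => hkl (hx h)
    have h2 : y k ≠ y l := fun h => hkl (hy h)
    have h3 := hxy k l
    have h4 := hxy l k
    simp only [Set.mem_insert_iff, Set.mem_singleton_iff] at hv hv' ⊢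
    rcases hv with h | h | h | h | h
    · simp [h]
    · subst h
      simp [h2, h4.symm, hya, hyb, hyd] at hv'
    · simp [h]
    · simp [h]
    · subst h
      simp [h1, h3, hxa, hxb, hxd] at hv'
  · intro k l hkl e he he' hS
    have : x k ∈ e ∨ y k ∈ e := by
      simp only [Set.mem_insert_iff, Set.mem_singleton_iff] at he
      rcases he with rfl | rfl | rfl | rfl <;> simp
    rcases this with h | h
    · have := hS _ h
      simp [hxa, hxb, hxd] at this
    · have := hS _ h
      simp [hya, hyb, hyd] at this

lemma index_eq {V : Type*} {G : SimpleGraph V} {k ℓ t : ℕ} (c : Sym2 V → Fin t)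
    (h : HasRainbowSTrees G c k ℓ)
    (hlow : ∀ (s : ℕ) (c : Sym2 V → Fin s), HasRainbowSTrees G c k ℓ → t ≤ s) :
    rainbowIndex G k ℓ = t := by
  apply le_antisymm
  · exact Nat.sInf_le ⟨c, h⟩
  · refine le_csInf ⟨t, c, h⟩ ?_
    rintro s ⟨c', h'⟩
    exact hlow s c' h'

lemma fin3_case {p q s : Fin 3} (h : ¬ (p ≠ q ∧ p ≠ s ∧ q ≠ s)) :
    ∃ i, p ≠ i ∧ q ≠ i ∧ s ≠ i := by
  revert p q s
  decide

lemma four_case {r : ℕ} (hr : 4 ≤ r) (p q s : Fin r) : ∃ i, p ≠ i ∧ q ≠ i ∧ s ≠ i := by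
  have : ((({p, q, s} : Finset (Fin r))ᶜ).Nonempty) := by
    rw [← Finset.card_pos, Finset.card_compl]
    have := Finset.card_le_three (a := p) (b := q) (c := s)
    simp only [Fintype.card_fin]
    omega
  obtain ⟨i, hi⟩ := this
  simp at hi
  exact ⟨i, Ne.symm hi.1, Ne.symm hi.2.1, Ne.symm hi.2.2⟩

end upper

theorem rx3l_multipartite (ℓ r : ℕ) (hℓ : 1 ≤ ℓ) (hr : 3 ≤ r) :
    ∃ N : ℕ, 0 < N ∧ ∀ n : ℕ, N ≤ n →
      ((r = 3 ∧ (ℓ = 1 ∨ ℓ = 2 ∨ ℓ = 3)) →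
        rainbowIndex (completeMultipartiteGraph (fun _ : Fin r => Fin n)) 3 ℓ = 3) ∧
      ((r = 3 ∧ 4 ≤ ℓ) →
        rainbowIndex (completeMultipartiteGraph (fun _ : Fin r => Fin n)) 3 ℓ = 4) ∧
      (4 ≤ r →
        rainbowIndex (completeMultipartiteGraph (fun _ : Fin r => Fin n)) 3 ℓ = 3) := by
  obtain ⟨N3, h3⟩ := exists_universal r 3 (ℓ + 3) (by norm_num)
  obtain ⟨N4, h4⟩ := exists_universal r 4 (ℓ + 1) (by norm_num)
  refine ⟨N3 + N4 + 3, by omega, fun n hn => ⟨?_, ?_, ?_⟩⟩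
  · rintro ⟨rfl, hl⟩
    obtain ⟨c, hc⟩ := h3 n (by omega)
    have hc2 : Universal c 2 := fun i a b d h1 h2 h3 g => by
      obtain ⟨F, hF, hF'⟩ := hc i a b d h1 h2 h3 g
      exact ⟨F, by omega, hF'⟩
    refine index_eq c (rainbow_mono (m := 3) (by omega) ?_)
      (fun s c' h => lower3 (by norm_num) (by omega) hℓ c' h)
    intro S hS
    obtain ⟨a, b, d, hab, had, hbd, rfl⟩ := Finset.card_eq_three.1 hS
    rw [Finset.coe_insert, Finset.coe_insert, Finset.coe_singleton]
    by_cases htr : a.1 ≠ b.1 ∧ a.1 ≠ d.1 ∧ b.1 ≠ d.1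
    · exact upper_three hc2 le_rfl htr.1 htr.2.1 htr.2.2
    · obtain ⟨i, h1, h2, h3⟩ := fin3_case htr
      exact upper_star hc (by omega) le_rfl i h1 h2 h3 hab had hbd
  · rintro ⟨rfl, hl⟩
    obtain ⟨c, hc⟩ := h4 n (by omega)
    refine index_eq c ?_ (fun s c' h => lower4 (by omega) hl c' h)
    intro S hS
    obtain ⟨a, b, d, hab, had, hbd, rfl⟩ := Finset.card_eq_three.1 hS
    rw [Finset.coe_insert, Finset.coe_insert, Finset.coe_singleton]
    by_cases htr : a.1 ≠ b.1 ∧ a.1 ≠ d.1 ∧ b.1 ≠ d.1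
    · exact upper_four hc le_rfl htr.1 htr.2.1 htr.2.2
    · obtain ⟨i, h1, h2, h3⟩ := fin3_case htr
      exact upper_star hc (by omega) (by norm_num) i h1 h2 h3 hab had hbd
  · intro hr4
    obtain ⟨c, hc⟩ := h3 n (by omega)
    refine index_eq c ?_ (fun s c' h => lower3 (by omega) (by omega) hℓ c' h)
    intro S hS
    obtain ⟨a, b, d, hab, had, hbd, rfl⟩ := Finset.card_eq_three.1 hS
    rw [Finset.coe_insert, Finset.coe_insert, Finset.coe_singleton]
    obtain ⟨i, h1, h2, h3⟩ := four_case hr4 a.1 b.1 d.1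
    exact upper_star hc (by omega) le_rfl i h1 h2 h3 hab had hbd
end

section
/- Let α ≥ 1 be a real number and C > 0 a constant. For each ℓ ∈ {1, 2, 3}, there exists a positive integer N = N(ℓ,C,α) such that for all integers n_1 ≤ n_2 ≤ n_3 with n_1 ≥ N and n_3 ≤ C·n_1^α, the complete tripartite graph K_{n_1,n_2,n_3} satisfies rx_{3,ℓ}(K_{n_1,n_2,n_3}) = 3. -/
open SimpleGraph

namespace RX

lemma card_edge_coe {V : Type*} {G : SimpleGraph V} (T : G.Subgraph) :
    Nat.card T.coe.edgeSet = T.edgeSet.ncard := by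
  rw [← Subgraph.image_coe_edgeSet_coe, Set.ncard_image_of_injective _
    (Sym2.map.injective Subtype.val_injective)]
  rfl

lemma tree_exists {V β : Type*} [Finite V] {G : SimpleGraph V} (c : Sym2 V → β)
    {p q r w t : V} (hpq : p ≠ q) (hpr : p ≠ r) (hqr : q ≠ r)
    (h1 : G.Adj w p) (h2 : G.Adj w q) (h3 : G.Adj t r) (hwr : w ≠ r) (ht : t = w ∨ t = q)
    (c12 : c s(w, p) ≠ c s(w, q)) (c13 : c s(w, p) ≠ c s(t, r)) (c23 : c s(w, q) ≠ c s(t, r)) :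
    ∃ T : G.Subgraph, T.verts = {p, q, r, w} ∧ T.edgeSet = {s(w, p), s(w, q), s(t, r)} ∧
      T.coe.IsTree ∧ Set.InjOn c T.edgeSet := by
  have hwp := h1.ne
  have hwq := h2.ne
  set T : G.Subgraph := (G.subgraphOfAdj h1 ⊔ G.subgraphOfAdj h2) ⊔ G.subgraphOfAdj h3 with hT
  have hv : T.verts = {p, q, r, w} := by
    ext x
    simp only [hT, Subgraph.verts_sup, subgraphOfAdj_verts, Set.mem_union, Set.mem_insert_iff,
      Set.mem_singleton_iff]
    grind
  have he : T.edgeSet = {s(w, p), s(w, q), s(t, r)} := by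
    ext x
    simp only [hT, Subgraph.edgeSet_sup, edgeSet_subgraphOfAdj, Set.mem_union, Set.mem_insert_iff,
      Set.mem_singleton_iff]
    tauto
  refine ⟨T, hv, he, ?_, ?_⟩
  · rw [isTree_iff_connected_and_card]
    refine ⟨?_, ?_⟩
    · have A : (G.subgraphOfAdj h1 ⊔ G.subgraphOfAdj h2).Connected :=
        Subgraph.connected_sup (Subgraph.subgraphOfAdj_connected h1).preconnected
          (Subgraph.subgraphOfAdj_connected h2).preconnected ⟨w, by simp⟩
      have B : T.Connected :=
        Subgraph.connected_sup A.preconnected (Subgraph.subgraphOfAdj_connected h3).preconnected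
          ⟨t, by rcases ht with rfl | rfl <;> simp⟩
      exact B.coe
    · rw [card_edge_coe, he]
      have : Nat.card T.verts = T.verts.ncard := rfl
      rw [this, hv]
      rw [Set.ncard_eq_three.2 ⟨_, _, _, ?_, ?_, ?_, rfl⟩]
      · rw [Set.ncard_insert_of_notMem (by simp [*, hwp.symm]),
          Set.ncard_eq_three.2 ⟨_, _, _, hqr, hwq.symm, hwr.symm, rfl⟩]
      · exact fun h => c12 (congrArg c h)
      · exact fun h => c13 (congrArg c h)
      · exact fun h => c23 (congrArg c h)
  · rw [he]
    rintro a (rfl | rfl | rfl) b (rfl | rfl | rfl) hab <;> first | rfl | (exfalso; tauto)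

/-- Updating step of the counting argument. -/
lemma count_step {E : Type*} [Fintype E] [DecidableEq E] (A : Finset (E → Fin 3)) (e1 e2 e3 : E)
    (h12 : e1 ≠ e2) (h13 : e1 ≠ e3) (h23 : e2 ≠ e3)
    (hA : ∀ c ∈ A, Function.update (Function.update (Function.update c e1 0) e2 1) e3 2 ∈ A) :
    27 * (A.filter fun c => ¬ (c e1 = 0 ∧ c e2 = 1 ∧ c e3 = 2)).card ≤ 26 * A.card := by
  have h := Finset.card_filter_add_card_filter_not (s := A)
    (fun c => (c e1 = 0 ∧ c e2 = 1 ∧ c e3 = 2))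
  have key : A.card ≤ ((A.filter fun c => (c e1 = 0 ∧ c e2 = 1 ∧ c e3 = 2)) ×ˢ
      (Finset.univ : Finset (Fin 3 × Fin 3 × Fin 3))).card := by
    refine Finset.card_le_card_of_injOn
      (fun c => (Function.update (Function.update (Function.update c e1 0) e2 1) e3 2,
        (c e1, c e2, c e3))) ?_ ?_
    · intro c hc
      simp only [Finset.coe_product, Set.mem_prod, Finset.mem_coe, Finset.mem_filter,
        Finset.mem_univ, and_true]
      refine ⟨hA c hc, ?_, ?_, ?_⟩ <;> simp [Function.update_apply, *]
    · intro c _ c' _ hcc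
      simp only [Prod.mk.injEq] at hcc
      obtain ⟨hu, a1, a2, a3⟩ := hcc
      funext e
      have := congrFun hu e
      simp only [Function.update_apply] at this
      by_cases E3 : e = e3
      · rw [E3, a3]
      by_cases E2 : e = e2
      · rw [E2, a2]
      by_cases E1 : e = e1
      · rw [E1, a1]
      simpa [E1, E2, E3] using this
  rw [Finset.card_product] at key
  simp at key
  omega

lemma count_bad {V : Type*} [Fintype V] [DecidableEq V] (x y z : V) (hxy : x ≠ y) (hxz : x ≠ z)
    (hyz : y ≠ z) (B : Finset V) (hx : x ∉ B) (hy : y ∉ B) (hz : z ∉ B) :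
    27 ^ B.card * ((Finset.univ : Finset (Sym2 V → Fin 3)).filter
      fun c => ∀ w ∈ B, ¬ (c s(w, x) = 0 ∧ c s(w, y) = 1 ∧ c s(w, z) = 2)).card
    ≤ 26 ^ B.card * Fintype.card (Sym2 V → Fin 3) := by
  induction B using Finset.induction_on with
  | empty => simp
  | insert w B hw ih =>
    simp only [Finset.mem_insert, not_or] at hx hy hz
    have ih := ih hx.2 hy.2 hz.2
    set A := (Finset.univ : Finset (Sym2 V → Fin 3)).filter
      fun c => ∀ w ∈ B, ¬ (c s(w, x) = 0 ∧ c s(w, y) = 1 ∧ c s(w, z) = 2) with hAdef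
    have st := count_step A s(w, x) s(w, y) s(w, z) (by grind) (by grind) (by grind) (by
      intro c hc
      simp only [hAdef, Finset.mem_filter, Finset.mem_univ, true_and] at hc ⊢
      intro u hu
      have hne : ∀ a b, b ∉ B → s(u, a) ≠ s(w, b) := by
        intro a b hb h
        rw [Sym2.eq_iff] at h
        rcases h with ⟨rfl, _⟩ | ⟨h, h'⟩
        · exact hw hu
        · exact hb (h ▸ hu)
      simpa [Function.update_apply, hne, hx.2, hy.2, hz.2] using hc u hu)
    have e : (Finset.univ : Finset (Sym2 V → Fin 3)).filter
      (fun c => ∀ u ∈ insert w B, ¬ (c s(u, x) = 0 ∧ c s(u, y) = 1 ∧ c s(u, z) = 2)) =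
      A.filter (fun c => ¬ (c s(w, x) = 0 ∧ c s(w, y) = 1 ∧ c s(w, z) = 2)) := by
      ext c
      simp only [hAdef, Finset.mem_filter, Finset.mem_univ, true_and, Finset.forall_mem_insert]
      tauto
    rw [e, Finset.card_insert_of_notMem hw, pow_succ, pow_succ]
    nlinarith [Nat.mul_le_mul_left (27 ^ B.card) st]

lemma exists_coloring {V : Type*} [Fintype V] [DecidableEq V] (part : V → Fin 3) (m : ℕ)
    (g : Fin 3 → Fin 3 × Fin m → V) (hg : ∀ k, Function.Injective (g k))
    (hp : ∀ k a, part (g k a) = k)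
    (hcount : 9 * Fintype.card V ^ 3 * 26 ^ m < 27 ^ m) :
    ∃ c : Sym2 V → Fin 3, ∀ (k b : Fin 3) (x y z : V), x ≠ y → x ≠ z → y ≠ z →
      part x ≠ k → part y ≠ k → part z ≠ k →
      ∃ j, c s(g k (b, j), x) = 0 ∧ c s(g k (b, j), y) = 1 ∧ c s(g k (b, j), z) = 2 := by
  classical
  by_contra hcon
  push Not at hcon
  let B : Fin 3 → Fin 3 → Finset V := fun k b => Finset.univ.image fun j => g k (b, j)
  have hB : ∀ k b, (B k b).card = m := by
    intro k b
    rw [Finset.card_image_of_injective]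
    · simp
    · intro i j h
      have := hg k h
      simpa using this
  have hBp : ∀ k b v, part v ≠ k → v ∉ B k b := by
    intro k b v hv h
    simp only [B, Finset.mem_image, Finset.mem_univ, true_and] at h
    obtain ⟨j, rfl⟩ := h
    exact hv (hp _ _)
  let I : Finset ((Fin 3 × Fin 3) × V × V × V) := Finset.univ.filter fun t =>
    t.2.1 ≠ t.2.2.1 ∧ t.2.1 ≠ t.2.2.2 ∧ t.2.2.1 ≠ t.2.2.2 ∧ part t.2.1 ≠ t.1.1 ∧
      part t.2.2.1 ≠ t.1.1 ∧ part t.2.2.2 ≠ t.1.1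
  let Bad : (Fin 3 × Fin 3) × V × V × V → Finset (Sym2 V → Fin 3) := fun t =>
    Finset.univ.filter fun c => ∀ w ∈ B t.1.1 t.1.2,
      ¬ (c s(w, t.2.1) = 0 ∧ c s(w, t.2.2.1) = 1 ∧ c s(w, t.2.2.2) = 2)
  have hsub : (Finset.univ : Finset (Sym2 V → Fin 3)) ⊆ I.biUnion Bad := by
    intro c _
    obtain ⟨k, b, x, y, z, h1, h2, h3, h4, h5, h6, h⟩ := hcon c
    rw [Finset.mem_biUnion]
    refine ⟨((k, b), x, y, z), by simp [I, *], ?_⟩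
    simp only [Bad, B, Finset.mem_filter, Finset.mem_univ, true_and, Finset.mem_image]
    rintro w ⟨j, rfl⟩ ⟨q1, q2, q3⟩
    exact h j q1 q2 q3
  have h1 := (Finset.card_le_card hsub).trans Finset.card_biUnion_le
  have h2 : 27 ^ m * ∑ t ∈ I, (Bad t).card ≤
      I.card * (26 ^ m * Fintype.card (Sym2 V → Fin 3)) := by
    rw [Finset.mul_sum, ← smul_eq_mul (I.card), ← Finset.sum_const]
    refine Finset.sum_le_sum fun t ht => ?_
    simp only [I, Finset.mem_filter, Finset.mem_univ, true_and] at ht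
    obtain ⟨h1, h2, h3, h4, h5, h6⟩ := ht
    have := count_bad t.2.1 t.2.2.1 t.2.2.2 h1 h2 h3 (B t.1.1 t.1.2) (hBp _ _ _ h4) (hBp _ _ _ h5)
      (hBp _ _ _ h6)
    rw [hB] at this
    exact this
  have h3 : I.card ≤ 9 * Fintype.card V ^ 3 := by
    refine (Finset.card_le_univ I).trans (le_of_eq ?_)
    simp only [Fintype.card_prod, Fintype.card_fin]
    ring
  have hpos : 0 < Fintype.card (Sym2 V → Fin 3) := Fintype.card_pos
  rw [Finset.card_univ] at h1
  have h4 := Nat.mul_le_mul_left (27 ^ m) h1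
  have h5 := Nat.mul_le_mul_right (26 ^ m * Fintype.card (Sym2 V → Fin 3)) h3
  have h6 := Nat.mul_lt_mul_of_pos_right hcount hpos
  have h7 : 27 ^ m * Fintype.card (Sym2 V → Fin 3) ≤
    9 * Fintype.card V ^ 3 * 26 ^ m * Fintype.card (Sym2 V → Fin 3) := by
    calc _ ≤ _ := h4.trans (h2.trans h5)
      _ = _ := by ring
  omega

lemma trees {V : Type*} [Finite V] {G : SimpleGraph V} (part : V → Fin 3)
    (hG : ∀ u v, G.Adj u v ↔ part u ≠ part v) (m : ℕ) (hm : 0 < m)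
    (g : Fin 3 → Fin 3 × Fin m → V) (hg : ∀ k, Function.Injective (g k))
    (hp : ∀ k a, part (g k a) = k) (c : Sym2 V → Fin 3)
    (hc : ∀ (k b : Fin 3) (x y z : V), x ≠ y → x ≠ z → y ≠ z →
      part x ≠ k → part y ≠ k → part z ≠ k →
      ∃ j, c s(g k (b, j), x) = 0 ∧ c s(g k (b, j), y) = 1 ∧ c s(g k (b, j), z) = 2) :
    HasRainbowSTrees G c 3 3 := by
  classical
  intro S hS
  obtain ⟨x, y, z, hxy, hxz, hyz, rfl⟩ := Finset.card_eq_three.1 hS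
  by_cases hk : ∃ k, part x ≠ k ∧ part y ≠ k ∧ part z ≠ k
  · obtain ⟨k, hx, hy, hz⟩ := hk
    choose j hj using fun b => hc k b x y z hxy hxz hyz hx hy hz
    set w : Fin 3 → V := fun b => g k (b, j b) with hw
    have hwk : ∀ b, part (w b) = k := fun b => hp _ _
    have hwi : ∀ a b, a ≠ b → w a ≠ w b := by
      intro a b hab h
      exact hab (congrArg Prod.fst (hg k h))
    have hwx : ∀ b, w b ≠ x := fun b h => hx (h ▸ hwk b)
    have hwy : ∀ b, w b ≠ y := fun b h => hy (h ▸ hwk b)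
    have hwz : ∀ b, w b ≠ z := fun b h => hz (h ▸ hwk b)
    have hT : ∀ b, ∃ T : G.Subgraph, T.verts = {x, y, z, w b} ∧
        T.edgeSet = {s(w b, x), s(w b, y), s(w b, z)} ∧
        T.coe.IsTree ∧ Set.InjOn c T.edgeSet := by
      intro b
      obtain ⟨j1, j2, j3⟩ := hj b
      refine tree_exists c hxy hxz hyz ?_ ?_ ?_ (hwz b) (Or.inl rfl) ?_ ?_ ?_
      · rw [hG, hwk]; exact hx.symm
      · rw [hG, hwk]; exact hy.symm
      · rw [hG, hwk]; exact hz.symm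
      all_goals simp [hw, j1, j2, j3]
    choose T hTv hTe hTt hTc using hT
    refine ⟨T, fun i => ⟨?_, hTt i, hTc i⟩, fun a b hab => ⟨?_, ?_⟩⟩
    · rw [hTv]; intro v; simp; tauto
    · have := hwi a b hab
      have := hwx a; have := hwy a; have := hwz a
      have := hwx b; have := hwy b; have := hwz b
      rw [hTe, hTe, Set.eq_empty_iff_forall_notMem]
      rintro e ⟨h1, h2⟩
      simp only [Set.mem_insert_iff, Set.mem_singleton_iff] at h1 h2
      rcases h1 with rfl | rfl | rfl <;> rcases h2 with h2 | h2 | h2 <;>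
        (rw [Sym2.eq_iff] at h2; tauto)
    · have := hwi a b hab
      have := hwx a; have := hwy a; have := hwz a
      have := hwx b; have := hwy b; have := hwz b
      rw [hTv, hTv]
      ext e
      simp only [Set.mem_inter_iff, Set.mem_insert_iff, Set.mem_singleton_iff, Finset.coe_insert,
        Finset.coe_singleton]
      grind
  · push Not at hk
    -- all three parts are met
    have hv : ∀ k, ∃ v, part v = k ∧ (v = x ∨ v = y ∨ v = z) := by
      intro k
      by_cases h1 : part x = k
      · exact ⟨x, h1, by simp⟩
      by_cases h2 : part y = k
      · exact ⟨y, h2, by simp⟩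
      exact ⟨z, hk k h1 h2, by simp⟩
    choose v hvp hvS using hv
    have hvi : ∀ a b, a ≠ b → v a ≠ v b := by
      intro a b hab h
      exact hab (by rw [← hvp a, ← hvp b, h])
    have h01 := hvi 0 1 (by decide)
    have h02 := hvi 0 2 (by decide)
    have h12 := hvi 1 2 (by decide)
    have hSv : ({x, y, z} : Set V) = {v 0, v 1, v 2} := by
      ext e
      simp only [Set.mem_insert_iff, Set.mem_singleton_iff]
      have := hvS 0; have := hvS 1; have := hvS 2
      grind
    have hw : ∀ k, ∃ w, part w = k ∧ w ≠ v k ∧ c s(w, v (k+1)) ≠ c s(w, v (k+2)) ∧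
        c s(w, v (k+1)) ≠ c s(v (k+2), v k) ∧ c s(w, v (k+2)) ≠ c s(v (k+2), v k) := by
      intro k
      have n1 : k + 1 ≠ k := by revert k; decide
      have n2 : k + 2 ≠ k := by revert k; decide
      have n3 : k + 1 ≠ k + 2 := by revert k; decide
      have hu : ∃ u, part u ≠ k ∧ u ≠ v (k+1) ∧ u ≠ v (k+2) := by
        by_cases h : g (k+1) (0, ⟨0, hm⟩) = v (k+1)
        · refine ⟨g (k+1) (1, ⟨0, hm⟩), by rw [hp]; exact n1, ?_, ?_⟩
          · rw [← h]
            intro h'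
            have := hg _ h'
            simp at this
          · intro h'
            have := congrArg part h'
            rw [hp, hvp] at this
            exact n3 this
        · refine ⟨_, by rw [hp]; exact n1, h, ?_⟩
          intro h'
          have := congrArg part h'
          rw [hp, hvp] at this
          exact n3 this
      obtain ⟨u, hu0, hu1, hu2⟩ := hu
      have hwb : ∀ b, ∃ j, c s(g k (b, j), v (k+1)) ≠ c s(g k (b, j), v (k+2)) ∧
          c s(g k (b, j), v (k+1)) ≠ c s(v (k+2), v k) ∧
          c s(g k (b, j), v (k+2)) ≠ c s(v (k+2), v k) := by
        intro b
        have q1 : part (v (k+1)) ≠ k := by rw [hvp]; exact n1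
        have q2 : part (v (k+2)) ≠ k := by rw [hvp]; exact n2
        have q3 := hvi _ _ n3
        generalize c s(v (k+2), v k) = d
        have hd : d = 0 ∨ d = 1 ∨ d = 2 := by revert d; decide
        rcases hd with rfl | rfl | rfl
        · obtain ⟨j, j1, j2, j3⟩ := hc k b u (v (k+1)) (v (k+2)) hu1 hu2 q3 hu0 q1 q2
          exact ⟨j, by simp [j2, j3]⟩
        · obtain ⟨j, j1, j2, j3⟩ := hc k b (v (k+1)) u (v (k+2)) hu1.symm q3 hu2 q1 hu0 q2
          exact ⟨j, by simp [j1, j3]⟩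
        · obtain ⟨j, j1, j2, j3⟩ := hc k b (v (k+1)) (v (k+2)) u q3 hu1.symm hu2.symm q1 q2 hu0
          exact ⟨j, by simp [j1, j2]⟩
      obtain ⟨j0, hj0⟩ := hwb 0
      obtain ⟨j1, hj1⟩ := hwb 1
      by_cases h : g k (0, j0) = v k
      · refine ⟨_, hp _ _, ?_, hj1⟩
        rw [← h]
        intro h'
        have := hg _ h'
        simp at this
      · exact ⟨_, hp _ _, h, hj0⟩
    choose w hwp hwv hw1 hw2 hw3 using hw
    have hwv' : ∀ a b, w a ≠ v b := by
      intro a b h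
      have hab : a = b := by rw [← hwp a, ← hvp b, h]
      subst hab
      exact hwv a h
    have hwi : ∀ a b, a ≠ b → w a ≠ w b := by
      intro a b hab h
      exact hab (by rw [← hwp a, ← hwp b, h])
    have hT : ∀ k, ∃ T : G.Subgraph, T.verts = {v (k+1), v (k+2), v k, w k} ∧
        T.edgeSet = {s(w k, v (k+1)), s(w k, v (k+2)), s(v (k+2), v k)} ∧
        T.coe.IsTree ∧ Set.InjOn c T.edgeSet := by
      intro k
      have n1 : k + 1 ≠ k := by revert k; decide
      have n2 : k + 2 ≠ k := by revert k; decide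
      have n3 : k + 1 ≠ k + 2 := by revert k; decide
      refine tree_exists c (hvi _ _ n3) (hvi _ _ n1) (hvi _ _ n2) ?_ ?_ ?_ (hwv k) (Or.inr rfl)
        (hw1 k) (hw2 k) (hw3 k)
      · rw [hG, hwp, hvp]; exact n1.symm
      · rw [hG, hwp, hvp]; exact n2.symm
      · rw [hG, hvp, hvp]; exact n2
    choose T hTv hTe hTt hTc using hT
    have hTv' : ∀ k, (T k).verts = {v 0, v 1, v 2, w k} := by
      intro k
      rw [hTv]
      ext e
      fin_cases k <;> simp [show (1:Fin 3) + 2 = 0 from rfl, show (2:Fin 3) + 2 = 1 from rfl,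
        show (1:Fin 3) + 1 = 2 from rfl, show (2:Fin 3) + 1 = 0 from rfl] <;> tauto
    have hS' : ((({x, y, z} : Finset V) : Finset V) : Set V) = {v 0, v 1, v 2} := by
      rw [← hSv]; simp
    rw [hS']
    refine ⟨T, fun i => ⟨?_, hTt i, hTc i⟩, fun a b hab => ⟨?_, ?_⟩⟩
    · rw [hTv']; intro v; simp; tauto
    · have h1 := hwi a b hab
      have h2 := hwv' a
      have h3 := hwv' b
      have h4 : s(v (a+2), v a) ≠ s(v (b+2), v b) := by
        intro h
        rw [Sym2.eq_iff] at h
        rcases h with ⟨_, h⟩ | ⟨h, h'⟩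
        · exact hvi _ _ hab h
        · have e1 : a + 2 = b := by by_contra q; exact hvi _ _ q h
          have e2 : a = b + 2 := by by_contra q; exact hvi _ _ q h'
          clear h h' h1 h2 h3
          revert a b; decide
      rw [hTe, hTe, Set.eq_empty_iff_forall_notMem]
      rintro e ⟨g1, g2⟩
      simp only [Set.mem_insert_iff, Set.mem_singleton_iff] at g1 g2
      rcases g1 with rfl | rfl | rfl <;> rcases g2 with g2 | g2 | g2 <;>
        first
        | exact h4 g2
        | (rw [Sym2.eq_iff] at g2; grind)
    · have h1 := hwi a b hab
      have h2 := hwv' a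
      have h3 := hwv' b
      rw [hTv', hTv']
      ext e
      simp only [Set.mem_inter_iff, Set.mem_insert_iff, Set.mem_singleton_iff]
      have := h2 0; have := h2 1; have := h2 2
      grind

lemma trees_mono {V β : Type*} {G : SimpleGraph V} {c : Sym2 V → β} {k l l' : ℕ} (h : l ≤ l')
    (H : HasRainbowSTrees G c k l') : HasRainbowSTrees G c k l := by
  intro S hS
  obtain ⟨T, h1, h2⟩ := H S hS
  exact ⟨fun i => T (Fin.castLE h i), fun i => h1 _, fun i j hij => h2 _ _ (by simpa using hij)⟩

lemma lower {V : Type*} [Finite V] {G : SimpleGraph V} (part : V → Fin 3)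
    (hG : ∀ u v, G.Adj u v ↔ part u ≠ part v) (S : Finset V) (hS : S.card = 3) (k : Fin 3)
    (hSk : ∀ v ∈ S, part v = k) (l t : ℕ) (hl : 0 < l) (c : Sym2 V → Fin t)
    (H : HasRainbowSTrees G c 3 l) : 3 ≤ t := by
  by_contra ht
  obtain ⟨T, h1, -⟩ := H S hS
  obtain ⟨a, b, d⟩ := h1 ⟨0, hl⟩
  generalize T ⟨0, hl⟩ = T at a b d
  have hcard := (isTree_iff_connected_and_card.1 b).2
  rw [card_edge_coe] at hcard
  change _ = T.verts.ncard at hcard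
  have he : T.edgeSet.ncard ≤ t := by
    rw [← d.ncard_image]
    refine (Set.ncard_le_card _).trans ?_
    simp
  have hs : (S : Set V).ncard = 3 := by rw [Set.ncard_coe_finset, hS]
  have hle := Set.ncard_le_ncard a
  have heq : (S : Set V) = T.verts := Set.eq_of_subset_of_ncard_le a (by omega)
  have hne : T.edgeSet.Nonempty := by
    rw [← Set.ncard_pos]; omega
  obtain ⟨e, he⟩ := hne
  induction e with | _ u v =>
  have hadj : T.Adj u v := he
  have hu : u ∈ S := by
    have := hadj.fst_mem; rw [← heq] at this; exact this
  have hv : v ∈ S := by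
    have := hadj.snd_mem; rw [← heq] at this; exact this
  exact (hG u v).1 hadj.adj_sub (by rw [hSk u hu, hSk v hv])

lemma asym (α : ℝ) (C : ℝ) : ∃ N : ℕ, ∀ n₁ n₃ : ℕ, N ≤ n₁ →
    (n₃ : ℝ) ≤ C * (n₁ : ℝ) ^ α → 9 * (3 * n₃) ^ 3 * 26 ^ (n₁ / 3) < 27 ^ (n₁ / 3) := by
  obtain ⟨k, hk⟩ := exists_nat_ge α
  have ht := (tendsto_pow_const_mul_const_pow_of_abs_lt_one (3 * k) (r := 26 / 27)
    (by rw [abs_lt]; norm_num)).const_mul (243 * |C| ^ 3 * 6 ^ (3 * k))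
  rw [mul_zero] at ht
  have hev := ht.eventually (gt_mem_nhds (show (0:ℝ) < 1 by norm_num))
  obtain ⟨M, hM⟩ := Filter.eventually_atTop.1 hev
  refine ⟨3 * M + 3, fun n₁ n₃ hn h => ?_⟩
  set m := n₁ / 3 with hm
  have h1 := hM m (by omega)
  have hn1 : (n₁ : ℝ) ≤ 6 * m := by
    have : n₁ ≤ 6 * m := by omega
    exact_mod_cast this
  have hone : (1:ℝ) ≤ n₁ := by
    have : 1 ≤ n₁ := by omega
    exact_mod_cast this
  have h2 : (n₃ : ℝ) ≤ |C| * (6 * m) ^ k := by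
    calc (n₃ : ℝ) ≤ C * (n₁ : ℝ) ^ α := h
      _ ≤ |C| * (n₁ : ℝ) ^ α := by gcongr; exact le_abs_self C
      _ ≤ |C| * (n₁ : ℝ) ^ (k : ℝ) := by gcongr
      _ = |C| * (n₁ : ℝ) ^ k := by rw [Real.rpow_natCast]
      _ ≤ _ := by gcongr
  have h3 : (9 * (3 * n₃) ^ 3 : ℝ) * (26 / 27) ^ m < 1 := by
    calc (9 * (3 * n₃) ^ 3 : ℝ) * (26 / 27) ^ m
        ≤ (9 * (3 * (|C| * (6 * m) ^ k)) ^ 3 : ℝ) * (26 / 27) ^ m := by gcongr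
      _ = 243 * |C| ^ 3 * 6 ^ (3 * k) * (m ^ (3 * k) * (26 / 27) ^ m) := by
        rw [mul_pow 6, mul_comm 3 k, pow_mul, pow_mul]; ring
      _ < 1 := h1
  rw [div_pow, mul_div_assoc', div_lt_one (by positivity)] at h3
  exact_mod_cast h3

end RX

theorem rx3l_general_tripartite (α : ℝ) (hα : 1 ≤ α) (C : ℝ) (hC : 0 < C)
    (ℓ : ℕ) (hℓ : ℓ = 1 ∨ ℓ = 2 ∨ ℓ = 3) :
    ∃ N : ℕ, 0 < N ∧ ∀ n₁ n₂ n₃ : ℕ, N ≤ n₁ → n₁ ≤ n₂ → n₂ ≤ n₃ →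
      (n₃ : ℝ) ≤ C * (n₁ : ℝ) ^ α →
      rainbowIndex (completeMultipartiteGraph ![Fin n₁, Fin n₂, Fin n₃]) 3 ℓ = 3 := by
  classical
  obtain ⟨N, hN⟩ := RX.asym α C
  refine ⟨N + 3, by omega, fun n₁ n₂ n₃ h1 h12 h23 h3 => ?_⟩
  have hcnt := hN n₁ n₃ (by omega) h3
  have hfin : ∀ i, Finite (![Fin n₁, Fin n₂, Fin n₃] i) := by
    intro i
    fin_cases i
    · exact inferInstanceAs (Finite (Fin n₁))
    · exact inferInstanceAs (Finite (Fin n₂))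
    · exact inferInstanceAs (Finite (Fin n₃))
  have hcard : ∀ i, n₁ ≤ Nat.card (![Fin n₁, Fin n₂, Fin n₃] i) ∧
      Nat.card (![Fin n₁, Fin n₂, Fin n₃] i) ≤ n₃ := by
    intro i
    fin_cases i <;> simp <;> omega
  generalize hW : ![Fin n₁, Fin n₂, Fin n₃] = W at *
  letI : ∀ i, Fintype (W i) := fun i => Fintype.ofFinite _
  have hVcard : Fintype.card (Σ i, W i) ≤ 3 * n₃ := by
    rw [Fintype.card_sigma, Fin.sum_univ_three]
    have := (hcard 0).2; have := (hcard 1).2; have := (hcard 2).2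
    simp only [Nat.card_eq_fintype_card] at *
    omega
  have hemb : ∀ k, Nonempty (Fin 3 × Fin (n₁ / 3) ↪ W k) := by
    intro k
    apply Function.Embedding.nonempty_of_card_le
    have := (hcard k).1
    rw [Nat.card_eq_fintype_card] at this
    simp only [Fintype.card_prod, Fintype.card_fin]
    omega
  have g0 := fun k => Classical.choice (hemb k)
  let g : Fin 3 → Fin 3 × Fin (n₁ / 3) → (Σ i, W i) := fun k a => ⟨k, g0 k a⟩
  have hg : ∀ k, Function.Injective (g k) := by
    intro k a b h
    simpa [g] using h
  have hG : ∀ u v, (completeMultipartiteGraph W).Adj u v ↔ Sigma.fst u ≠ Sigma.fst v := by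
    intro u v; simp
  have hm : 0 < n₁ / 3 := by omega
  obtain ⟨c, hc⟩ := RX.exists_coloring (V := Σ i, W i) Sigma.fst (n₁ / 3) g hg (fun _ _ => rfl)
    (lt_of_le_of_lt (by gcongr) hcnt)
  have H := RX.trees (G := completeMultipartiteGraph W) Sigma.fst hG (n₁ / 3) hm g hg
    (fun _ _ => rfl) c hc
  have hlow : ∀ t, t ∈ {t : ℕ | ∃ c : Sym2 (Σ i, W i) → Fin t,
      HasRainbowSTrees (completeMultipartiteGraph W) c 3 ℓ} → 3 ≤ t := by
    rintro t ⟨c, hc⟩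
    refine RX.lower Sigma.fst hG (Finset.univ.image fun b : Fin 3 => g 0 (b, ⟨0, hm⟩)) ?_ 0 ?_
      ℓ t (by omega) c hc
    · rw [Finset.card_image_of_injective]
      · simp
      · intro a b h
        have := hg 0 h
        simpa using this
    · intro v hv
      simp only [Finset.mem_image] at hv
      obtain ⟨b, _, rfl⟩ := hv
      rfl
  have hmem : 3 ∈ {t : ℕ | ∃ c : Sym2 (Σ i, W i) → Fin t,
      HasRainbowSTrees (completeMultipartiteGraph W) c 3 ℓ} :=
    ⟨c, RX.trees_mono (by omega) H⟩
  exact le_antisymm (Nat.sInf_le hmem) (hlow _ (Nat.sInf_mem ⟨3, hmem⟩))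
end
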